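/- arXiv:1509.07600 — 2 statements merged into one kernel-verified Lean document; each statement's English description precedes it below -/
import Mathlib

section
/- For every scenario s and every point x ∈ [v_1, v_n], the regret satisfies R^s(x) = max_{1 ≤ i ≤ n} Γ^s(x, v_i), and consequently the maximum regret satisfies R_max(x) = max_{1 ≤ i ≤ n} sup_{s ∈ S} Γ^s(x, v_i). -/
open Finset
open scoped Classical

namespace DPN

noncomputable def score (τ c : ℝ) (v w : ℕ → ℝ) (h r j : ℕ) : ℝ :=
  τ * (v h - v j) + (∑ l ∈ Finset.Ioc r j, w l) / c

noncomputable def nextHead (τ c : ℝ) (v w : ℕ → ℝ) (h r : ℕ) : ℕ :=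
  (((Finset.Ioc r h).filter (fun j =>
      ∀ j' ∈ Finset.Ioc r h, score τ c v w h r j' ≤ score τ c v w h r j)).max).getD h

noncomputable def heads (τ c : ℝ) (v w : ℕ → ℝ) (h : ℕ) : ℕ → ℕ
  | 0 => 0
  | m + 1 => nextHead τ c v w h (heads τ c v w h m)

noncomputable def hIdx (n : ℕ) (v : ℕ → ℝ) (x : ℝ) : ℕ :=
  ((Finset.Icc 1 n).filter (fun i => v i < x)).card

noncomputable def phiL (n : ℕ) (τ c : ℝ) (v w : ℕ → ℝ) (x : ℝ) : ℝ :=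
  ∑ m ∈ Finset.range n,
    ((∑ l ∈ Finset.Ioc (heads τ c v w (hIdx n v x) m) (heads τ c v w (hIdx n v x) (m + 1)), w l) *
        (τ * (x - v (heads τ c v w (hIdx n v x) (m + 1)))) +
      (∑ l ∈ Finset.Ioc (heads τ c v w (hIdx n v x) m) (heads τ c v w (hIdx n v x) (m + 1)), w l) ^ 2 /
        (2 * c))

def rv (n : ℕ) (v : ℕ → ℝ) : ℕ → ℝ := fun l => -v (n + 1 - l)

def rw (n : ℕ) (w : ℕ → ℝ) : ℕ → ℝ := fun l => w (n + 1 - l)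

noncomputable def phiR (n : ℕ) (τ c : ℝ) (v w : ℕ → ℝ) (x : ℝ) : ℝ :=
  phiL n τ c (rv n v) (rw n w) (-x)

noncomputable def phi (n : ℕ) (τ c : ℝ) (v w : ℕ → ℝ) (x : ℝ) : ℝ :=
  phiL n τ c v w x + phiR n τ c v w x

/-- The set of scenarios: each vertex weight lies in its interval. -/
def scenarios (n : ℕ) (wm wp : ℕ → ℝ) : Set (ℕ → ℝ) :=
  {s | ∀ i, 1 ≤ i → i ≤ n → wm i ≤ s i ∧ s i ≤ wp i}

/-- The gap `Γ^s(x, y) = Φ^s(x) − Φ^s(y)`. -/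
noncomputable def gap (n : ℕ) (τ c : ℝ) (v s : ℕ → ℝ) (x y : ℝ) : ℝ :=
  phi n τ c v s x - phi n τ c v s y

/-- The regret `R^s(x) = Φ^s(x) − Φ^s(m^s)` (`Φ^s(m^s)` = min of `Φ^s` on `[v_1, v_n]`). -/
noncomputable def regret (n : ℕ) (τ c : ℝ) (v s : ℕ → ℝ) (x : ℝ) : ℝ :=
  phi n τ c v s x - sInf ((fun z => phi n τ c v s z) '' Set.Icc (v 1) (v n))

/-- The maximum regret `R_max(x) = sup_{s ∈ S} R^s(x)`. -/
noncomputable def maxRegret (n : ℕ) (τ c : ℝ) (v wm wp : ℕ → ℝ) (x : ℝ) : ℝ :=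
  sSup {r | ∃ s ∈ scenarios n wm wp, r = regret n τ c v s x}

/-- The left-pseudo-bipartite scenario `s(i, w)`. -/
def pseudoBipL (wm wp : ℕ → ℝ) (i : ℕ) (w : ℝ) : ℕ → ℝ :=
  fun l => if l < i then wp l else if l = i then w else wm l

/-- The right-pseudo-bipartite scenario `s(i, w)`. -/
def pseudoBipR (wm wp : ℕ → ℝ) (i : ℕ) (w : ℝ) : ℕ → ℝ :=
  fun l => if l < i then wm l else if l = i then w else wp l

/-- The head `ρ_m` of the left cluster containing vertex `i`: the smallest cluster head `≥ i`. -/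
noncomputable def clusterHeadOf (τ c : ℝ) (v w : ℕ → ℝ) (h i : ℕ) : ℕ :=
  ((((Finset.range (h + 1)).image (heads τ c v w h)).filter (fun r => i ≤ r)).min).getD h

/-- The head `ρ_{m−1}` preceding the left cluster containing vertex `i`:
the largest cluster head `< i`. -/
noncomputable def prevClusterHeadOf (τ c : ℝ) (v w : ℕ → ℝ) (h i : ℕ) : ℕ :=
  ((((Finset.range (h + 1)).image (heads τ c v w h)).filter (fun r => r < i)).max).getD 0

/-- The weight `σ_m` of the left cluster containing vertex `i`. -/
noncomputable def clusterWeightOf (τ c : ℝ) (v w : ℕ → ℝ) (h i : ℕ) : ℝ :=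
  ∑ l ∈ Finset.Ioc (prevClusterHeadOf τ c v w h i) (clusterHeadOf τ c v w h i), w l

/-- The sequence of right cluster heads for the vertex `y = v_j`
(expressed in the coordinates of the reflected network). -/
noncomputable def rightHeads (n : ℕ) (τ c : ℝ) (v w : ℕ → ℝ) (j : ℕ) : ℕ → ℕ :=
  heads τ c (rv n v) (rw n w) (hIdx n (rv n v) (-(v j)))

/-- The sequence of left cluster heads for the vertex `y = v_j`. -/
noncomputable def leftHeads (n : ℕ) (τ c : ℝ) (v w : ℕ → ℝ) (j : ℕ) : ℕ → ℕ :=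
  heads τ c v w (hIdx n v (v j))

/-- The (original-coordinates) index of the head of the right cluster for `y = v_j`
containing vertex `i`. -/
noncomputable def rightClusterHeadOf (n : ℕ) (τ c : ℝ) (v w : ℕ → ℝ) (j i : ℕ) : ℕ :=
  n + 1 - clusterHeadOf τ c (rv n v) (rw n w) (hIdx n (rv n v) (-(v j))) (n + 1 - i)

/-- The weight of the right cluster for `y = v_j` containing vertex `i`. -/
noncomputable def rightClusterWeightOf (n : ℕ) (τ c : ℝ) (v w : ℕ → ℝ) (j i : ℕ) : ℝ :=
  clusterWeightOf τ c (rv n v) (rw n w) (hIdx n (rv n v) (-(v j))) (n + 1 - i)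

/-- `ω` is a critical weight for `v_i` with respect to the vertex `y = v_j`
(left-pseudo-bipartite case): `ω ∈ {w_i^−, w_i^+}` or the right-cluster partition for `y`
under `s(i, ·)` is not constant on any neighborhood of `ω` in `[w_i^−, w_i^+]`. -/
def criticalWeightL (n : ℕ) (τ c : ℝ) (v wm wp : ℕ → ℝ) (j i : ℕ) (ω : ℝ) : Prop :=
  ω ∈ Set.Icc (wm i) (wp i) ∧
    (ω = wm i ∨ ω = wp i ∨
      ¬ ∃ ε > (0 : ℝ), ∀ w ∈ Set.Icc (wm i) (wp i), |w - ω| < ε →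
        rightHeads n τ c v (pseudoBipL wm wp i w) j =
          rightHeads n τ c v (pseudoBipL wm wp i ω) j)

/-- `ω` is a critical weight for `v_i` with respect to the vertex `y = v_j`
(right-pseudo-bipartite case, using the left-cluster partition for `y`). -/
def criticalWeightR (n : ℕ) (τ c : ℝ) (v wm wp : ℕ → ℝ) (j i : ℕ) (ω : ℝ) : Prop :=
  ω ∈ Set.Icc (wm i) (wp i) ∧
    (ω = wm i ∨ ω = wp i ∨
      ¬ ∃ ε > (0 : ℝ), ∀ w ∈ Set.Icc (wm i) (wp i), |w - ω| < ε →
        leftHeads n τ c v (pseudoBipR wm wp i w) j =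
          leftHeads n τ c v (pseudoBipR wm wp i ω) j)

/-- `Q`: the number of right clusters for `y = v_j` under weights `w` that lie entirely
to the right of the right cluster containing `v_i` (counted via reflected cluster heads). -/
noncomputable def Qnum (n : ℕ) (τ c : ℝ) (v w : ℕ → ℝ) (j i : ℕ) : ℕ :=
  (((Finset.range (n + 1)).image (rightHeads n τ c v w j)).filter
      (fun r => 1 ≤ r ∧
        r < clusterHeadOf τ c (rv n v) (rw n w) (hIdx n (rv n v) (-(v j))) (n + 1 - i))).card

end DPN

open DPN

namespace DPN

/-- The total cost of the first `N` clusters formed after the head `r`, observed from `x`. -/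
noncomputable def clusterCost (τ c : ℝ) (v w : ℕ → ℝ) (h : ℕ) (x : ℝ) : ℕ → ℕ → ℝ
  | 0, _ => 0
  | N + 1, r =>
    ((∑ l ∈ Finset.Ioc r (nextHead τ c v w h r), w l) * (τ * (x - v (nextHead τ c v w h r))) +
      (∑ l ∈ Finset.Ioc r (nextHead τ c v w h r), w l) ^ 2 / (2 * c)) +
      clusterCost τ c v w h x N (nextHead τ c v w h r)

lemma nextHead_self (τ c : ℝ) (v w : ℕ → ℝ) (h : ℕ) : nextHead τ c v w h h = h := by
  unfold nextHead
  rw [Finset.Ioc_self, Finset.filter_empty, Finset.max_empty]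
  rfl

lemma nextHead_spec (τ c : ℝ) (v w : ℕ → ℝ) {h r : ℕ} (hr : r < h) :
    (r < nextHead τ c v w h r ∧ nextHead τ c v w h r ≤ h) ∧
      (∀ j, r < j → j ≤ h →
        score τ c v w h r j ≤ score τ c v w h r (nextHead τ c v w h r)) ∧
      ∀ j, r < j → j ≤ h →
        (∀ j', r < j' → j' ≤ h → score τ c v w h r j' ≤ score τ c v w h r j) →
          j ≤ nextHead τ c v w h r := by
  set F := (Finset.Ioc r h).filter (fun j =>
      ∀ j' ∈ Finset.Ioc r h, score τ c v w h r j' ≤ score τ c v w h r j) with hF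
  have hne : F.Nonempty := by
    obtain ⟨j, hj, hmax⟩ := Finset.exists_max_image (Finset.Ioc r h) (score τ c v w h r)
      ⟨h, Finset.mem_Ioc.mpr ⟨hr, le_rfl⟩⟩
    exact ⟨j, Finset.mem_filter.mpr ⟨hj, hmax⟩⟩
  obtain ⟨a, ha⟩ := Finset.max_of_nonempty hne
  have hn : nextHead τ c v w h r = a := by
    unfold nextHead
    rw [← hF, ha]
    rfl
  have hmem := Finset.mem_of_max ha
  rw [hF, Finset.mem_filter, Finset.mem_Ioc] at hmem
  rw [hn]
  refine ⟨hmem.1, fun j h1 h2 => hmem.2 j (Finset.mem_Ioc.mpr ⟨h1, h2⟩), fun j h1 h2 h3 => ?_⟩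
  refine Finset.le_max_of_eq (s := F) ?_ ha
  rw [hF, Finset.mem_filter, Finset.mem_Ioc]
  refine ⟨⟨h1, h2⟩, fun j' hj' => ?_⟩
  rw [Finset.mem_Ioc] at hj'
  exact h3 j' hj'.1 hj'.2

lemma le_nextHead (τ c : ℝ) (v w : ℕ → ℝ) {h r : ℕ} (hr : r ≤ h) :
    r ≤ nextHead τ c v w h r ∧ nextHead τ c v w h r ≤ h := by
  rcases hr.eq_or_lt with rfl | hr
  · simp [nextHead_self]
  · have := (nextHead_spec τ c v w hr).1
    exact ⟨this.1.le, this.2⟩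

lemma nextHead_eq_of_le (τ c : ℝ) (v w : ℕ → ℝ) {h r : ℕ} (hr : r < h)
    (hle : nextHead τ c v w (h + 1) r ≤ h) :
    nextHead τ c v w h r = nextHead τ c v w (h + 1) r := by
  obtain ⟨⟨a1, a2⟩, a3, a4⟩ := nextHead_spec τ c v w hr
  obtain ⟨⟨b1, b2⟩, b3, b4⟩ := nextHead_spec τ c v w (Nat.lt_succ_of_lt hr)
  have key : ∀ j, score τ c v w (h + 1) r j = score τ c v w h r j + τ * (v (h + 1) - v h) := by
    intro j
    unfold score
    ring
  simp only [key] at b3 b4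
  apply le_antisymm
  · refine b4 _ a1 (a2.trans (Nat.le_succ h)) fun j h1 h2 => ?_
    have e1 := b3 j h1 h2
    have e2 := a3 _ b1 hle
    linarith
  · refine a4 _ b1 hle fun j h1 h2 => ?_
    have := b3 j h1 (h2.trans (Nat.le_succ h))
    linarith

lemma clusterCost_self (τ c : ℝ) (v w : ℕ → ℝ) (h : ℕ) (x : ℝ) (N : ℕ) :
    clusterCost τ c v w h x N h = 0 := by
  induction N with
  | zero => rfl
  | succ N ih => simp [clusterCost, nextHead_self, ih]

lemma sum_Ioc_weights_nonneg {w : ℕ → ℝ} {h : ℕ} (hw : ∀ i, 1 ≤ i → i ≤ h → 0 ≤ w i)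
    {a b : ℕ} (hb : b ≤ h) : 0 ≤ ∑ l ∈ Finset.Ioc a b, w l := by
  refine Finset.sum_nonneg fun i hi => ?_
  rw [Finset.mem_Ioc] at hi
  exact hw i (by omega) (by omega)

lemma clusterCost_le_sq {τ c : ℝ} (hc : 0 < c) (v w : ℕ → ℝ) {h : ℕ}
    (hw : ∀ i, 1 ≤ i → i ≤ h → 0 ≤ w i) (x : ℝ) (N : ℕ) :
    ∀ (r : ℕ) (M : ℝ), r ≤ h →
      (∀ j, r < j → j ≤ h → τ * (x - v j) + (∑ l ∈ Finset.Ioc r j, w l) / c ≤ M / c) →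
      clusterCost τ c v w h x N r ≤ M ^ 2 / (2 * c) := by
  induction N with
  | zero => intro r M _ _; simp only [clusterCost]; positivity
  | succ N ih =>
    intro r M hr hM
    rcases hr.eq_or_lt with rfl | hr
    · rw [clusterCost_self]; positivity
    obtain ⟨⟨a1, a2⟩, -, -⟩ := nextHead_spec τ c v w hr
    rw [clusterCost]
    set q := nextHead τ c v w h r
    set σ := ∑ l ∈ Finset.Ioc r q, w l with hσ
    have hσ0 : 0 ≤ σ := sum_Ioc_weights_nonneg hw a2
    have h1 : τ * (x - v q) ≤ (M - σ) / c := by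
      have := hM q a1 a2
      rw [sub_div]
      linarith
    have h2 := ih q (M - σ) a2 fun j hj1 hj2 => by
      have h3 := hM j (a1.trans hj1) hj2
      rw [← Finset.sum_Ioc_consecutive w a1.le hj1.le, ← hσ, add_div] at h3
      rw [sub_div]
      linarith
    have h4 := mul_le_mul_of_nonneg_left h1 hσ0
    have h5 : σ * ((M - σ) / c) + σ ^ 2 / (2 * c) + (M - σ) ^ 2 / (2 * c) = M ^ 2 / (2 * c) := by
      field_simp
      ring
    linarith

/-- Passing the vertex `h + 1` cannot decrease the cost observed at that vertex. -/
lemma clusterCost_le_succ {τ c : ℝ} (hc : 0 < c) (v w : ℕ → ℝ) {h : ℕ}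
    (hw : ∀ i, 1 ≤ i → i ≤ h → 0 ≤ w i) (N : ℕ) :
    ∀ r, r ≤ h → clusterCost τ c v w h (v (h + 1)) N r ≤
      clusterCost τ c v w (h + 1) (v (h + 1)) N r := by
  induction N with
  | zero => intro r _; exact le_rfl
  | succ N ih =>
    intro r hr
    obtain ⟨⟨b1, b2⟩, b3, -⟩ := nextHead_spec τ c v w (show r < h + 1 by omega)
    by_cases hq : nextHead τ c v w (h + 1) r ≤ h
    · have hr' : r < h := lt_of_lt_of_le b1 hq
      have e := nextHead_eq_of_le τ c v w hr' hq
      rw [clusterCost, clusterCost, e]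
      have := ih _ hq
      linarith
    · have hq' : nextHead τ c v w (h + 1) r = h + 1 := by omega
      rw [clusterCost.eq_2 τ c v w (h + 1), hq', clusterCost_self]
      have := clusterCost_le_sq hc v w hw (v (h + 1)) (N + 1) r
        (∑ l ∈ Finset.Ioc r (h + 1), w l) hr fun j h1 h2 => by
          have := b3 j h1 (h2.trans (Nat.le_succ h))
          rw [hq'] at this
          simpa [score] using this
      simpa using this

lemma exists_clusterCost_affine (τ c : ℝ) (v w : ℕ → ℝ) (h N : ℕ) :
    ∀ r, ∃ a b : ℝ, ∀ x, clusterCost τ c v w h x N r = a * x + b := by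
  induction N with
  | zero => exact fun r => ⟨0, 0, fun x => by simp [clusterCost]⟩
  | succ N ih =>
    intro r
    obtain ⟨a, b, hab⟩ := ih (nextHead τ c v w h r)
    refine ⟨(∑ l ∈ Finset.Ioc r (nextHead τ c v w h r), w l) * τ + a,
      (∑ l ∈ Finset.Ioc r (nextHead τ c v w h r), w l) * (τ * -v (nextHead τ c v w h r)) +
      (∑ l ∈ Finset.Ioc r (nextHead τ c v w h r), w l) ^ 2 / (2 * c) + b, fun x => ?_⟩
    rw [clusterCost, hab]
    ring

lemma clusterCost_heads_eq_sum (τ c : ℝ) (v w : ℕ → ℝ) (h : ℕ) (x : ℝ) (N : ℕ) :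
    ∀ k, clusterCost τ c v w h x N (heads τ c v w h k) = ∑ m ∈ Finset.range N,
      ((∑ l ∈ Finset.Ioc (heads τ c v w h (k + m)) (heads τ c v w h (k + m + 1)), w l) *
        (τ * (x - v (heads τ c v w h (k + m + 1)))) +
      (∑ l ∈ Finset.Ioc (heads τ c v w h (k + m)) (heads τ c v w h (k + m + 1)), w l) ^ 2 /
        (2 * c)) := by
  induction N with
  | zero => intro k; simp [clusterCost]
  | succ N ih =>
    intro k
    rw [Finset.sum_range_succ', clusterCost, add_comm]
    refine congrArg₂ (· + ·) ((ih (k + 1)).trans (Finset.sum_congr rfl fun m _ => ?_)) rfl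
    rw [show k + (m + 1) = k + 1 + m by omega]

lemma phiL_eq_clusterCost (n : ℕ) (τ c : ℝ) (v w : ℕ → ℝ) (x : ℝ) :
    phiL n τ c v w x = clusterCost τ c v w (hIdx n v x) x n 0 := by
  have := clusterCost_heads_eq_sum τ c v w (hIdx n v x) x n 0
  simp only [zero_add] at this
  exact this.symm

lemma hIdx_eq {n : ℕ} {v : ℕ → ℝ} {x : ℝ} {k : ℕ} (hk : k ≤ n)
    (h : ∀ i, 1 ≤ i → i ≤ n → (v i < x ↔ i ≤ k)) : hIdx n v x = k := by
  have : (Finset.Icc 1 n).filter (fun i => v i < x) = Finset.Icc 1 k := by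
    ext i
    simp only [Finset.mem_filter, Finset.mem_Icc]
    constructor
    · rintro ⟨⟨h1, h2⟩, h3⟩
      exact ⟨h1, (h i h1 h2).mp h3⟩
    · rintro ⟨h1, h2⟩
      exact ⟨⟨h1, h2.trans hk⟩, (h i h1 (h2.trans hk)).mpr h2⟩
  unfold hIdx
  rw [this]
  simp

lemma hIdx_le (n : ℕ) (v : ℕ → ℝ) (x : ℝ) : hIdx n v x ≤ n := by
  unfold hIdx
  exact (Finset.card_filter_le _ _).trans (by simp)

lemma strictMonoOn_positions {n : ℕ} {v : ℕ → ℝ} (hv : ∀ i, 1 ≤ i → i < n → v i < v (i + 1))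
    {i j : ℕ} (hi : 1 ≤ i) (hij : i < j) (hj : j ≤ n) : v i < v j := by
  induction j, hij using Nat.le_induction with
  | base => exact hv i hi hj
  | succ j hij ih => exact (ih (by omega)).trans (hv j (by omega) hj)

lemma monotoneOn_positions {n : ℕ} {v : ℕ → ℝ} (hv : ∀ i, 1 ≤ i → i < n → v i < v (i + 1))
    {i j : ℕ} (hi : 1 ≤ i) (hij : i ≤ j) (hj : j ≤ n) : v i ≤ v j := by
  rcases hij.eq_or_lt with rfl | h
  · exact le_rfl
  · exact (strictMonoOn_positions hv hi h hj).le

lemma hIdx_of_mem_Ioc {n : ℕ} {v : ℕ → ℝ} (hv : ∀ i, 1 ≤ i → i < n → v i < v (i + 1))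
    {h : ℕ} (hn : h < n) {x : ℝ} (h1 : h = 0 ∨ v h < x) (h2 : x ≤ v (h + 1)) :
    hIdx n v x = h := by
  refine hIdx_eq hn.le fun i hi1 hi2 => ⟨fun hx => ?_, fun hi => ?_⟩
  · by_contra hlt
    have := monotoneOn_positions hv (i := h + 1) (j := i) (by omega) (by omega) hi2
    linarith
  · have := monotoneOn_positions hv hi1 hi hn.le
    rcases h1 with h1 | h1
    · omega
    · linarith

lemma rv_lt_succ {n : ℕ} {v : ℕ → ℝ} (hv : ∀ i, 1 ≤ i → i < n → v i < v (i + 1)) :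
    ∀ i, 1 ≤ i → i < n → rv n v i < rv n v (i + 1) := by
  intro i h1 h2
  have := hv (n - i) (by omega) (by omega)
  unfold rv
  rw [show n + 1 - (i + 1) = n - i by omega, show n + 1 - i = n - i + 1 by omega]
  linarith

lemma min_le_phi {n : ℕ} {τ c : ℝ} (hc : 0 < c) {v w : ℕ → ℝ}
    (hv : ∀ i, 1 ≤ i → i < n → v i < v (i + 1)) (hw : ∀ i, 1 ≤ i → i ≤ n → 0 ≤ w i)
    {h : ℕ} (h1 : 1 ≤ h) (hn : h < n) {z : ℝ} (hz1 : v h < z) (hz2 : z < v (h + 1)) :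
    min (phi n τ c v w (v h)) (phi n τ c v w (v (h + 1))) ≤ phi n τ c v w z := by
  have hv' := rv_lt_succ hv
  have hrv0 : rv n v (n - h) = -v (h + 1) := by
    unfold rv; rw [show n + 1 - (n - h) = h + 1 by omega]
  have hrv1 : rv n v (n - h + 1) = -v h := by
    unfold rv; rw [show n + 1 - (n - h + 1) = h by omega]
  have hw' : ∀ i, 1 ≤ i → i ≤ n → 0 ≤ rw n w i := fun i _ _ => hw _ (by omega) (by omega)
  have hvh := hv h h1 hn
  have iz : hIdx n v z = h := hIdx_of_mem_Ioc hv hn (Or.inr hz1) hz2.le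
  have i1 : hIdx n v (v (h + 1)) = h := hIdx_of_mem_Ioc hv hn (Or.inr hvh) le_rfl
  have i0 : hIdx n v (v h) = h - 1 := by
    refine hIdx_of_mem_Ioc hv (by omega) ?_ (by rw [Nat.sub_add_cancel h1])
    by_cases hh : h = 1
    · left; omega
    · right; exact strictMonoOn_positions hv (by omega) (by omega) hn.le
  have jz : hIdx n (rv n v) (-z) = n - h :=
    hIdx_of_mem_Ioc hv' (by omega) (Or.inr (by rw [hrv0]; linarith)) (by rw [hrv1]; linarith)
  have j0 : hIdx n (rv n v) (-v h) = n - h :=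
    hIdx_of_mem_Ioc hv' (by omega) (Or.inr (by rw [hrv0]; linarith)) (by rw [hrv1])
  have j1 : hIdx n (rv n v) (-v (h + 1)) = n - h - 1 := by
    refine hIdx_of_mem_Ioc hv' (by omega) ?_
      (by rw [Nat.sub_add_cancel (by omega), hrv0])
    by_cases hh : n - h = 1
    · left; omega
    · right; rw [← hrv0]; exact strictMonoOn_positions hv' (by omega) (by omega) (by omega)
  have jumpL := clusterCost_le_succ (τ := τ) hc v w (h := h - 1)
    (fun i a b => hw i a (by omega)) n 0 (Nat.zero_le _)
  rw [Nat.sub_add_cancel h1] at jumpL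
  have jumpR := clusterCost_le_succ (τ := τ) hc (rv n v) (rw n w) (h := n - h - 1)
    (fun i a b => hw' i a (by omega)) n 0 (Nat.zero_le _)
  rw [Nat.sub_add_cancel (by omega), hrv0] at jumpR
  obtain ⟨a, b, hab⟩ := exists_clusterCost_affine τ c v w h n 0
  obtain ⟨a', b', hab'⟩ := exists_clusterCost_affine τ c (rv n v) (rw n w) (n - h) n 0
  unfold phi phiR
  simp only [phiL_eq_clusterCost, iz, i1, i0, jz, j0, j1]
  rw [hab] at jumpL
  rw [hab'] at jumpR
  simp only [hab, hab']
  rcases le_total a a' with haa | haa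
  · refine (min_le_right _ _).trans ?_
    have := mul_le_mul_of_nonneg_left hz2.le (sub_nonneg.mpr haa)
    linarith
  · refine (min_le_left _ _).trans ?_
    have := mul_le_mul_of_nonneg_left hz1.le (sub_nonneg.mpr haa)
    linarith

lemma exists_vertex_or_between {n : ℕ} (hn : 1 ≤ n) {v : ℕ → ℝ} {z : ℝ}
    (hz : z ∈ Set.Icc (v 1) (v n)) :
    (∃ i, 1 ≤ i ∧ i ≤ n ∧ z = v i) ∨ ∃ h, 1 ≤ h ∧ h < n ∧ v h < z ∧ z < v (h + 1) := by
  obtain ⟨h1, h2⟩ := hz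
  induction n, hn using Nat.le_induction with
  | base => exact Or.inl ⟨1, le_rfl, le_rfl, le_antisymm h2 h1⟩
  | succ n hn ih =>
    rcases le_or_gt z (v n) with hz | hz
    · rcases ih hz with ⟨i, a, b, e⟩ | ⟨h, a, b, e⟩
      · exact Or.inl ⟨i, a, by omega, e⟩
      · exact Or.inr ⟨h, a, by omega, e⟩
    · rcases h2.eq_or_lt with e | hlt
      · exact Or.inl ⟨n + 1, by omega, le_rfl, e⟩
      · exact Or.inr ⟨n, hn, by omega, hz, hlt⟩

lemma exists_vertex_phi_le {n : ℕ} (hn : 1 ≤ n) {τ c : ℝ} (hc : 0 < c) {v w : ℕ → ℝ}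
    (hv : ∀ i, 1 ≤ i → i < n → v i < v (i + 1)) (hw : ∀ i, 1 ≤ i → i ≤ n → 0 ≤ w i)
    {z : ℝ} (hz : z ∈ Set.Icc (v 1) (v n)) :
    ∃ i, 1 ≤ i ∧ i ≤ n ∧ phi n τ c v w (v i) ≤ phi n τ c v w z := by
  rcases exists_vertex_or_between hn hz with ⟨i, a, b, rfl⟩ | ⟨h, a, b, e1, e2⟩
  · exact ⟨i, a, b, le_rfl⟩
  · rcases min_le_iff.mp (min_le_phi (τ := τ) hc hv hw a b e1 e2) with h' | h'
    · exact ⟨h, a, b.le, h'⟩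
    · exact ⟨h + 1, by omega, b, h'⟩

lemma regret_eq_sup' {n : ℕ} (hn : 1 ≤ n) {τ c : ℝ} (hc : 0 < c) {v w : ℕ → ℝ}
    (hv : ∀ i, 1 ≤ i → i < n → v i < v (i + 1)) (hw : ∀ i, 1 ≤ i → i ≤ n → 0 ≤ w i) (x : ℝ) :
    regret n τ c v w x = (Finset.Icc 1 n).sup' (Finset.nonempty_Icc.mpr hn) fun i =>
      gap n τ c v w x (v i) := by
  obtain ⟨i₀, hi₀, hmin⟩ := Finset.exists_min_image (Finset.Icc 1 n)
    (fun i => phi n τ c v w (v i)) (Finset.nonempty_Icc.mpr hn)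
  have hi := Finset.mem_Icc.mp hi₀
  have hleast : IsLeast ((fun z => phi n τ c v w z) '' Set.Icc (v 1) (v n))
      (phi n τ c v w (v i₀)) := by
    refine ⟨⟨v i₀, ⟨monotoneOn_positions hv le_rfl hi.1 hi.2,
      monotoneOn_positions hv hi.1 hi.2 le_rfl⟩, rfl⟩, ?_⟩
    rintro _ ⟨z, hz, rfl⟩
    obtain ⟨i, h1, h2, h3⟩ := exists_vertex_phi_le (τ := τ) hn hc hv hw hz
    exact (hmin i (Finset.mem_Icc.mpr ⟨h1, h2⟩)).trans h3
  unfold regret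
  rw [hleast.csInf_eq]
  apply le_antisymm
  · exact Finset.le_sup' (fun i => gap n τ c v w x (v i)) hi₀
  · refine Finset.sup'_le _ _ fun i hi => ?_
    have := hmin i hi
    unfold gap
    linarith

lemma exists_abs_clusterCost_le (n : ℕ) {τ c : ℝ} (v b : ℕ → ℝ) (N : ℕ)
    (x : ℝ) : ∃ C : ℝ, ∀ w : ℕ → ℝ, (∀ i, 1 ≤ i → i ≤ n → |w i| ≤ b i) →
      ∀ h r, h ≤ n → r ≤ h → |clusterCost τ c v w h x N r| ≤ C := by
  set B := ∑ l ∈ Finset.Icc 1 n, |b l|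
  set V := ∑ l ∈ Finset.range (n + 1), |τ * (x - v l)|
  induction N with
  | zero => exact ⟨0, fun w _ h r _ _ => by simp [clusterCost]⟩
  | succ N ih =>
    obtain ⟨C, hC⟩ := ih
    refine ⟨B * V + B ^ 2 / |2 * c| + C, fun w hw h r hh hr => ?_⟩
    obtain ⟨a1, a2⟩ := le_nextHead τ c v w hr
    rw [clusterCost]
    set q := nextHead τ c v w h r
    have hrec := hC w hw h q hh a2
    have hσ : |∑ l ∈ Finset.Ioc r q, w l| ≤ B := by
      refine (Finset.abs_sum_le_sum_abs _ _).trans ?_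
      refine (Finset.sum_le_sum (g := fun l => |b l|) fun l hl => ?_).trans
        (Finset.sum_le_sum_of_subset_of_nonneg ?_ fun _ _ _ => abs_nonneg _)
      · rw [Finset.mem_Ioc] at hl
        exact (hw l (by omega) (by omega)).trans (le_abs_self _)
      · intro l hl
        rw [Finset.mem_Ioc] at hl
        rw [Finset.mem_Icc]
        omega
    have hV : |τ * (x - v q)| ≤ V :=
      Finset.single_le_sum (f := fun l => |τ * (x - v l)|) (fun _ _ => abs_nonneg _)
        (Finset.mem_range.mpr (by omega))
    refine (abs_add_le _ _).trans (add_le_add ((abs_add_le _ _).trans (add_le_add ?_ ?_)) hrec)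
    · rw [abs_mul]
      exact mul_le_mul hσ hV (abs_nonneg _) ((abs_nonneg _).trans hσ)
    · rw [abs_div, abs_pow]
      gcongr

lemma exists_abs_phi_le (n : ℕ) (τ c : ℝ) (v : ℕ → ℝ) {wm wp : ℕ → ℝ}
    (hwm : ∀ i, 1 ≤ i → i ≤ n → 0 < wm i) (x : ℝ) :
    ∃ C : ℝ, ∀ s ∈ scenarios n wm wp, |phi n τ c v s x| ≤ C := by
  obtain ⟨C, hC⟩ := exists_abs_clusterCost_le n (τ := τ) (c := c) v wp n x
  obtain ⟨C', hC'⟩ := exists_abs_clusterCost_le n (τ := τ) (c := c) (rv n v) (rw n wp) n (-x)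
  refine ⟨C + C', fun s hs => ?_⟩
  have hb : ∀ i, 1 ≤ i → i ≤ n → |s i| ≤ wp i := fun i h1 h2 => by
    obtain ⟨h3, h4⟩ := hs i h1 h2
    rwa [abs_of_nonneg ((hwm i h1 h2).le.trans h3)]
  unfold phi phiR
  rw [phiL_eq_clusterCost, phiL_eq_clusterCost]
  refine (abs_add_le _ _).trans (add_le_add ?_ ?_)
  · exact hC s hb _ 0 (hIdx_le _ _ _) (Nat.zero_le _)
  · exact hC' _ (fun i _ _ => hb _ (by omega) (by omega)) _ 0 (hIdx_le _ _ _) (Nat.zero_le _)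

lemma bddAbove_gap (n : ℕ) (τ c : ℝ) (v : ℕ → ℝ) {wm wp : ℕ → ℝ}
    (hwm : ∀ i, 1 ≤ i → i ≤ n → 0 < wm i) (x y : ℝ) :
    BddAbove {g | ∃ s ∈ scenarios n wm wp, g = gap n τ c v s x y} := by
  obtain ⟨C, hC⟩ := exists_abs_phi_le n τ c v (wp := wp) hwm x
  obtain ⟨C', hC'⟩ := exists_abs_phi_le n τ c v (wp := wp) hwm y
  refine ⟨C + C', ?_⟩
  rintro _ ⟨s, hs, rfl⟩
  have h1 := (abs_le.mp (hC s hs)).2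
  have h2 := (abs_le.mp (hC' s hs)).1
  unfold gap
  linarith

end DPN

theorem stmt3 (n : ℕ) (τ c : ℝ) (hτ : 0 < τ) (hc : 0 < c) (v : ℕ → ℝ)
    (hv : ∀ i, 1 ≤ i → i < n → v i < v (i + 1)) (hn : 1 ≤ n)
    (wm wp : ℕ → ℝ) (hwm : ∀ i, 1 ≤ i → i ≤ n → 0 < wm i)
    (hwmp : ∀ i, 1 ≤ i → i ≤ n → wm i ≤ wp i)
    (x : ℝ) (hx : x ∈ Set.Icc (v 1) (v n)) :
    (∀ s ∈ scenarios n wm wp,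
        regret n τ c v s x =
          (Finset.Icc 1 n).sup' (Finset.nonempty_Icc.mpr hn) fun i =>
            gap n τ c v s x (v i)) ∧
      maxRegret n τ c v wm wp x =
        (Finset.Icc 1 n).sup' (Finset.nonempty_Icc.mpr hn) fun i =>
          sSup {g | ∃ s ∈ scenarios n wm wp, g = gap n τ c v s x (v i)} := by
  have hreg : ∀ s ∈ scenarios n wm wp, regret n τ c v s x =
      (Finset.Icc 1 n).sup' (Finset.nonempty_Icc.mpr hn) fun i => gap n τ c v s x (v i) :=
    fun s hs => regret_eq_sup' hn hc hv
      (fun i h1 h2 => (hwm i h1 h2).le.trans (hs i h1 h2).1) x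
  refine ⟨hreg, ?_⟩
  have hmem : wm ∈ scenarios n wm wp := fun i h1 h2 => ⟨le_rfl, hwmp i h1 h2⟩
  have hle : ∀ s ∈ scenarios n wm wp, regret n τ c v s x ≤
      (Finset.Icc 1 n).sup' (Finset.nonempty_Icc.mpr hn) fun i =>
        sSup {g | ∃ s ∈ scenarios n wm wp, g = gap n τ c v s x (v i)} := by
    intro s hs
    rw [hreg s hs]
    exact Finset.sup'_mono_fun fun i _ =>
      le_csSup (bddAbove_gap n τ c v hwm x (v i)) ⟨s, hs, rfl⟩
  unfold maxRegret
  apply le_antisymm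
  · refine csSup_le ⟨_, wm, hmem, rfl⟩ ?_
    rintro _ ⟨s, hs, rfl⟩
    exact hle s hs
  · refine Finset.sup'_le _ _ fun i hi => csSup_le ⟨_, wm, hmem, rfl⟩ ?_
    rintro _ ⟨s, hs, rfl⟩
    have h1 : gap n τ c v s x (v i) ≤ regret n τ c v s x := by
      rw [hreg s hs]
      exact Finset.le_sup' (fun i => gap n τ c v s x (v i)) hi
    have hbdd : BddAbove {r | ∃ s ∈ scenarios n wm wp, r = regret n τ c v s x} :=
      ⟨_, fun r ⟨s, hs, hr⟩ => hr.trans_le (hle s hs)⟩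
    exact h1.trans (le_csSup hbdd ⟨s, hs, rfl⟩)
end

section
/- Fix positive weights w_1, …, w_n, a point x ∈ [v_1, v_n], an index i with v_i < x, and δ > 0. Let w' be the weights obtained from w by replacing w_i with w_i + δ. If the left cluster heads for x under w' coincide with those under w, then Φ_L(x) computed with w' equals Φ_L(x) computed with w plus δ·τ·(x − v_ρ) + δ·σ/c + δ²/(2c), where ρ is the head of the left cluster for x containing v_i and σ is the weight of that cluster under w. -/
open Finset
open scoped Classical

open DPN

namespace DPN

lemma nextHead_le (τ c : ℝ) (v w : ℕ → ℝ) (h r : ℕ) : nextHead τ c v w h r ≤ h := by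
  unfold nextHead
  cases hmax : ((Ioc r h).filter (fun j =>
      ∀ j' ∈ Ioc r h, score τ c v w h r j' ≤ score τ c v w h r j)).max with
  | bot => exact le_refl h
  | coe a => exact (mem_Ioc.1 (mem_filter.1 (mem_of_max hmax)).1).2

lemma lt_nextHead (τ c : ℝ) (v w : ℕ → ℝ) {h r : ℕ} (hr : r < h) :
    r < nextHead τ c v w h r := by
  unfold nextHead
  cases hmax : ((Ioc r h).filter (fun j =>
      ∀ j' ∈ Ioc r h, score τ c v w h r j' ≤ score τ c v w h r j)).max with
  | bot => exact hr
  | coe a => exact (mem_Ioc.1 (mem_filter.1 (mem_of_max hmax)).1).1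

lemma nextHead_of_le (τ c : ℝ) (v w : ℕ → ℝ) {h r : ℕ} (hr : h ≤ r) :
    nextHead τ c v w h r = h := by
  unfold nextHead
  rw [Ioc_eq_empty_of_le hr]
  rfl

lemma heads_le (τ c : ℝ) (v w : ℕ → ℝ) (h m : ℕ) : heads τ c v w h m ≤ h := by
  cases m with
  | zero => exact Nat.zero_le h
  | succ m => exact nextHead_le τ c v w h _

lemma heads_mono (τ c : ℝ) (v w : ℕ → ℝ) (h : ℕ) : Monotone (heads τ c v w h) := by
  refine monotone_nat_of_le_succ fun m => ?_
  rcases lt_or_ge (heads τ c v w h m) h with hlt | hge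
  · exact (lt_nextHead τ c v w hlt).le
  · exact (heads_le τ c v w h m).trans (nextHead_of_le τ c v w hge).ge

lemma le_heads (τ c : ℝ) (v w : ℕ → ℝ) (h m : ℕ) (hm : heads τ c v w h m < h) :
    m ≤ heads τ c v w h m := by
  induction m with
  | zero => exact Nat.zero_le _
  | succ m ih =>
    have hlt : heads τ c v w h m < h := (heads_mono τ c v w h m.le_succ).trans_lt hm
    exact (ih hlt).trans_lt (lt_nextHead τ c v w hlt)

end DPN

lemma Finset.sum_update_add_of_mem {ι M : Type*} [DecidableEq ι] [AddCommMonoid M]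
    {s : Finset ι} {i : ι} (hi : i ∈ s) (f : ι → M) (a : M) :
    ∑ l ∈ s, Function.update f i (f i + a) l = ∑ l ∈ s, f l + a := by
  rw [sum_update_of_mem hi, ← add_sum_erase s f hi, sdiff_singleton_eq_erase]
  ac_rfl

theorem stmt5 (n : ℕ) (τ c : ℝ) (hτ : 0 < τ) (hc : 0 < c) (v : ℕ → ℝ)
    (hv : ∀ i, 1 ≤ i → i < n → v i < v (i + 1))
    (w : ℕ → ℝ) (hw : ∀ i, 1 ≤ i → i ≤ n → 0 < w i)
    (x : ℝ) (hx : x ∈ Set.Icc (v 1) (v n))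
    (i : ℕ) (hi1 : 1 ≤ i) (hin : i ≤ n) (hix : v i < x)
    (δ : ℝ) (hδ : 0 < δ)
    (hheads : ∀ m,
      heads τ c v (Function.update w i (w i + δ)) (hIdx n v x) m =
        heads τ c v w (hIdx n v x) m)
    (m : ℕ) (hm1 : heads τ c v w (hIdx n v x) m < i)
    (hm2 : i ≤ heads τ c v w (hIdx n v x) (m + 1)) :
    phiL n τ c v (Function.update w i (w i + δ)) x =
      phiL n τ c v w x + δ * τ * (x - v (heads τ c v w (hIdx n v x) (m + 1))) +
        δ * (∑ l ∈ Finset.Ioc (heads τ c v w (hIdx n v x) m)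
            (heads τ c v w (hIdx n v x) (m + 1)), w l) / c +
        δ ^ 2 / (2 * c) := by
  have hmn : m ∈ range n := by
    have hlt := hm1.trans_le (hm2.trans (heads_le τ c v w (hIdx n v x) (m + 1)))
    exact mem_range.2 ((le_heads τ c v w _ m hlt).trans_lt (hlt.trans_le (hIdx_le n v x)))
  simp only [phiL, hheads]
  generalize hIdx n v x = h at *
  rw [← add_sum_erase _ _ hmn, ← add_sum_erase (range n) _ hmn,
    sum_update_add_of_mem (mem_Ioc.2 ⟨hm1, hm2⟩)]
  have hrest : ∀ k ∈ (range n).erase m,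
      ∑ l ∈ Ioc (heads τ c v w h k) (heads τ c v w h (k + 1)),
        Function.update w i (w i + δ) l =
      ∑ l ∈ Ioc (heads τ c v w h k) (heads τ c v w h (k + 1)), w l := by
    intro k hk
    refine sum_update_of_notMem (fun hik => ?_) _ _
    obtain ⟨hk1, hk2⟩ := mem_Ioc.1 hik
    rcases lt_or_gt_of_ne (ne_of_mem_erase hk) with hlt | hgt
    · exact absurd (hk2.trans (heads_mono τ c v w h hlt)) hm1.not_ge
    · exact absurd (hm2.trans (heads_mono τ c v w h hgt)) hk1.not_ge
  rw [sum_congr rfl fun k hk => congrArg (fun s : ℝ =>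
    s * (τ * (x - v (heads τ c v w h (k + 1)))) + s ^ 2 / (2 * c)) (hrest k hk)]
  field_simp
  ring
end
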